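/- Let X₁, X₂, … be an associated sequence of integrable real random variables with E(X_i) = 0 for all i, and set S₀ = 0, S_n = X₁ + ⋯ + X_n. Then (S_n)_{n≥1} is a demimartingale: for every j ≥ 1 and every coordinatewise nondecreasing function g : ℝ^j → ℝ such that X_{j+1}·g(S₁,…,S_j) and g(S₁,…,S_j) are integrable, E[ (S_{j+1} − S_j) · g(S₁,…,S_j) ] ≥ 0. -/

import Mathlib

open MeasureTheory ProbabilityTheory Filter Topology

noncomputable section

/-- Covariance of two real random variables: `Cov(X,Y) = E(XY) - E(X)E(Y)`. -/
def cov {Ω : Type*} [MeasurableSpace Ω] (μ : Measure Ω) (X Y : Ω → ℝ) : ℝ :=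
  (∫ ω, X ω * Y ω ∂μ) - (∫ ω, X ω ∂μ) * (∫ ω, Y ω ∂μ)

/-- A function `h : ℝⁿ → ℝ` is coordinatewise nondecreasing. -/
def CoordwiseMono {n : ℕ} (h : (Fin n → ℝ) → ℝ) : Prop :=
  ∀ x y : Fin n → ℝ, (∀ i, x i ≤ y i) → h x ≤ h y

/-- A finite family `(X₁,…,Xₙ)` of real random variables is associated if for all
coordinatewise nondecreasing `h, g` for which the covariance exists,
`Cov(h(X₁,…,Xₙ), g(X₁,…,Xₙ)) ≥ 0`. -/
def IsAssociated {Ω : Type*} [MeasurableSpace Ω] (μ : Measure Ω) {n : ℕ}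
    (X : Fin n → Ω → ℝ) : Prop :=
  ∀ h g : (Fin n → ℝ) → ℝ, CoordwiseMono h → CoordwiseMono g →
    Integrable (fun ω => h (fun i => X i ω)) μ →
    Integrable (fun ω => g (fun i => X i ω)) μ →
    Integrable (fun ω => h (fun i => X i ω) * g (fun i => X i ω)) μ →
    0 ≤ cov μ (fun ω => h (fun i => X i ω)) (fun ω => g (fun i => X i ω))

/-- An infinite sequence of real random variables is associated if every finite
subfamily is associated. -/
def IsAssociatedSeq {Ω : Type*} [MeasurableSpace Ω] (μ : Measure Ω) (X : ℕ → Ω → ℝ) : Prop :=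
  ∀ (k : ℕ) (φ : Fin k → ℕ), IsAssociated μ (fun i => X (φ i))

/-- Convergence in distribution of a sequence of real random variables to a law `ν`:
integrals of bounded continuous functions converge. -/
def TendstoInDistrib {Ω : Type*} [MeasurableSpace Ω] (μ : Measure Ω)
    (Z : ℕ → Ω → ℝ) (ν : Measure ℝ) : Prop :=
  ∀ f : ℝ → ℝ, Continuous f → (∃ C, ∀ x, |f x| ≤ C) →
    Tendsto (fun n => ∫ ω, f (Z n ω) ∂μ) atTop (𝓝 (∫ x, f x ∂ν))

/-- **Partial sums of centered associated random variables form a demimartingale.**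
For every `j ≥ 1` and every coordinatewise nondecreasing `g` (with the relevant
integrabilities), `E[(S_{j+1} − S_j) g(S₁, …, S_j)] ≥ 0`. -/
theorem partial_sums_associated_demimartingale
    {Ω : Type*} [MeasurableSpace Ω] (μ : Measure Ω) [IsProbabilityMeasure μ]
    (X : ℕ → Ω → ℝ)
    (hmeas : ∀ i, Measurable (X i))
    (hint : ∀ i, Integrable (X i) μ)
    (hmean : ∀ i, ∫ ω, X i ω ∂μ = 0)
    (hassoc : IsAssociatedSeq μ X)
    (S : ℕ → Ω → ℝ)
    (hS : ∀ n ω, S n ω = ∑ i ∈ Finset.range n, X i ω)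
    (j : ℕ) (hj : 1 ≤ j)
    (g : (Fin j → ℝ) → ℝ)
    (hg : CoordwiseMono g)
    (hgint : Integrable (fun ω => g (fun i => S (i.1 + 1) ω)) μ)
    (hprodint : Integrable (fun ω => (S (j + 1) ω - S j ω) * g (fun i => S (i.1 + 1) ω)) μ) :
    0 ≤ ∫ ω, (S (j + 1) ω - S j ω) * g (fun i => S (i.1 + 1) ω) ∂μ := by
  have hA := hassoc (j + 1) (fun i => i.1) (fun x => x (Fin.last j))
    (fun x => g (fun i => ∑ k ∈ Finset.range (i.1 + 1), if hk : k < j + 1 then x ⟨k, hk⟩ else 0))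
    (fun x y hxy => hxy _)
    (fun x y hxy => hg _ _ (fun i => Finset.sum_le_sum (fun k _ => by
      split_ifs with hk
      · exact hxy _
      · exact le_rfl)))
  have e1 : ∀ ω, (fun i : Fin j => ∑ k ∈ Finset.range (i.1 + 1),
      if hk : k < j + 1 then X k ω else 0) = fun i : Fin j => S (i.1 + 1) ω := by
    intro ω
    funext i
    rw [hS]
    refine Finset.sum_congr rfl (fun k hk => ?_)
    have h1 := Finset.mem_range.1 hk
    have h2 := i.2
    rw [dif_pos (by omega)]
  have e2 : ∀ ω, S (j + 1) ω - S j ω = X j ω := by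
    intro ω
    rw [hS, hS, Finset.sum_range_succ]
    ring
  simp only [e2] at hprodint ⊢
  simp only [e1, Fin.val_last, cov] at hA
  have := hA (hint j) hgint hprodint
  rw [hmean j] at this
  linarith
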